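/- arXiv:2012.03772 — 2 statements merged into one kernel-verified Lean document; each statement's English description precedes it below -/
import Mathlib

section
/- Let Ω ⊂ ℝ^d be an open bounded domain satisfying the geodesic condition (D) and let the kernel η satisfy (K1)–(K3). Then for any null sequence (s_n) ⊂ (0,∞), the non-local functionals F_{s_n} Γ-converge in L^∞(Ω) to σ_η · F. -/
open MeasureTheory Filter Set Topology ENNReal

noncomputable section

/-- Euclidean space `ℝ^d`. -/
abbrev Euc (d : ℕ) := EuclideanSpace ℝ (Fin d)

variable {d : ℕ}

/-- The geodesic distance on `Ω` induced by the Euclidean distance: the infimal length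
(`eVariationOn`, i.e. the supremum of sums of distances over partitions) of continuous curves
`γ : [0,1] → ℝ^d` with `γ((0,1)) ⊆ Ω` (so that also endpoints in `∂Ω` can be reached),
`γ 0 = x` and `γ 1 = y`. -/
def geoDist (Ω : Set (Euc d)) (x y : Euc d) : ℝ≥0∞ :=
  ⨅ (γ : ℝ → Euc d) (_ : ContinuousOn γ (Set.Icc 0 1))
    (_ : Set.MapsTo γ (Set.Ioo 0 1) Ω) (_ : γ 0 = x) (_ : γ 1 = y),
    eVariationOn γ (Set.Icc 0 1)

/-- The geodesic distance function to a set `O`. -/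
def dGeo (Ω O : Set (Euc d)) (x : Euc d) : ℝ :=
  (⨅ y ∈ O, geoDist Ω x y).toReal

/-- Condition (D): `lim_{δ↓0} sup { d_Ω(x,y)/|x-y| : x,y ∈ Ω, |x-y| < δ } ≤ 1`. -/
def condD (Ω : Set (Euc d)) : Prop :=
  ∀ ε : ℝ, 0 < ε → ∃ δ : ℝ, 0 < δ ∧ ∀ x ∈ Ω, ∀ y ∈ Ω,
    dist x y < δ → geoDist Ω x y ≤ ENNReal.ofReal ((1 + ε) * dist x y)

/-- The kernel assumptions (K1)–(K3): `η : [0,∞) → [0,∞)` is positive and continuous at `0`,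
non-increasing, and has support contained in `[0,c]`. -/
structure IsKernel (η : ℝ → ℝ) (c : ℝ) : Prop where
  nonneg : ∀ t, 0 ≤ η t
  pos_zero : 0 < η 0
  cont_zero : ContinuousAt η 0
  antitone : AntitoneOn η (Set.Ici 0)
  c_pos : 0 < c
  compact_supp : ∀ t, c < t → η t = 0

/-- `σ_η := esssup_{t ≥ 0} η(t)·t`. -/
def sigmaEta (η : ℝ → ℝ) : ℝ≥0∞ :=
  essSup (fun t => ENNReal.ofReal (η t * t)) (volume.restrict (Set.Ici (0 : ℝ)))

/-- The `L^∞(Ω)` norm of a function. -/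
def einfNorm (Ω : Set (Euc d)) (u : Euc d → ℝ) : ℝ≥0∞ :=
  essSup (fun x => (‖u x‖₊ : ℝ≥0∞)) (volume.restrict Ω)

/-- Convergence in `L^∞(Ω)`. -/
def TendstoLinf (Ω : Set (Euc d)) (un : ℕ → Euc d → ℝ) (u : Euc d → ℝ) : Prop :=
  Filter.Tendsto (fun n => einfNorm Ω (fun x => un n x - u x)) Filter.atTop (nhds 0)

/-- A sequence is relatively compact in `L^∞(Ω)` iff every subsequence has a further
subsequence converging in `L^∞(Ω)`. -/
def SeqRelCompactLinf (Ω : Set (Euc d)) (un : ℕ → Euc d → ℝ) : Prop :=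
  ∀ φ : ℕ → ℕ, StrictMono φ → ∃ ψ : ℕ → ℕ, StrictMono ψ ∧
    ∃ v : Euc d → ℝ, TendstoLinf Ω (fun k => un (φ (ψ k))) v

/-- The non-local functional `F_s(u) = (1/s) esssup_{x,y∈Ω} η(|x-y|/s) |u(x) - u(y)|`. -/
def Fnl (Ω : Set (Euc d)) (η : ℝ → ℝ) (s : ℝ) (u : Euc d → ℝ) : ℝ≥0∞ :=
  ENNReal.ofReal (1 / s) *
    essSup (fun q : Euc d × Euc d => ENNReal.ofReal (η (dist q.1 q.2 / s) * |u q.1 - u q.2|))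
      ((volume.restrict Ω).prod (volume.restrict Ω))

/-- `v` is locally Lipschitz on `Ω`. -/
def LocLipOn (Ω : Set (Euc d)) (v : Euc d → ℝ) : Prop :=
  ∀ x ∈ Ω, ∃ ε : ℝ, 0 < ε ∧ ∃ K : NNReal, LipschitzOnWith K v (Metric.ball x ε ∩ Ω)

/-- `esssup_{x ∈ Ω} |∇v(x)|`. -/
def gradSup (Ω : Set (Euc d)) (v : Euc d → ℝ) : ℝ≥0∞ :=
  essSup (fun x => (‖fderiv ℝ v x‖₊ : ℝ≥0∞)) (volume.restrict Ω)

/-- The continuum functional `F(u) = esssup_{x∈Ω} |∇u(x)|` if `u ∈ W^{1,∞}(Ω)`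
(i.e. `u` has a locally Lipschitz representative on `Ω`, whose a.e. gradient is then taken),
and `F(u) = ∞` otherwise. -/
def Floc (Ω : Set (Euc d)) (u : Euc d → ℝ) : ℝ≥0∞ :=
  ⨅ (v : Euc d → ℝ) (_ : u =ᵐ[volume.restrict Ω] v) (_ : LocLipOn Ω v), gradSup Ω v

/-- The constrained continuum functional: additionally the representative must equal `g` on `O`. -/
def FlocCons (Ω O : Set (Euc d)) (g : Euc d → ℝ) (u : Euc d → ℝ) : ℝ≥0∞ :=
  ⨅ (v : Euc d → ℝ) (_ : u =ᵐ[volume.restrict Ω] v) (_ : LocLipOn Ω v)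
    (_ : Set.EqOn v g O), gradSup Ω v

/-- The discrete functional `E_n(𝐮) = (1/s) max_{x,y ∈ Ω_n} η(|x-y|/s) |𝐮(x) - 𝐮(y)|`. -/
def Edisc (Ωn : Set (Euc d)) (η : ℝ → ℝ) (s : ℝ) (f : Euc d → ℝ) : ℝ≥0∞ :=
  ENNReal.ofReal (1 / s) *
    ⨆ (x : Euc d) (_ : x ∈ Ωn) (y : Euc d) (_ : y ∈ Ωn),
      ENNReal.ofReal (η (dist x y / s) * |f x - f y|)

/-- The constrained discrete functional, extended to `L^∞(Ω)`: its value is `E_n(f)` if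
`u = f ∘ pₙ` (as elements of `L^∞(Ω)`) for a graph function `f` with `f = g` on `Oₙ`,
and `∞` otherwise. -/
def EdiscCons (Ω Ωn On : Set (Euc d)) (pn : Euc d → Euc d) (g : Euc d → ℝ)
    (η : ℝ → ℝ) (s : ℝ) (u : Euc d → ℝ) : ℝ≥0∞ :=
  ⨅ (f : Euc d → ℝ) (_ : u =ᵐ[volume.restrict Ω] fun x => f (pn x))
    (_ : Set.EqOn f g On), Edisc Ωn η s f

/-- `pn` is a closest point projection from `Ω` onto `Ωn`. -/
def IsCPP (Ω Ωn : Set (Euc d)) (pn : Euc d → Euc d) : Prop :=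
  ∀ x ∈ Ω, pn x ∈ Ωn ∧ ∀ y ∈ Ωn, dist x (pn x) ≤ dist x y

/-- The resolution `rₙ = sup_{x ∈ Ω} min_{y ∈ Ωₙ} |x - y|`. -/
def resol (Ω Ωn : Set (Euc d)) : ℝ := ⨆ x ∈ Ω, Metric.infDist x Ωn

lemma exists_mem_of_ae_restrict {Ω U : Set (Euc d)} (hU : IsOpen U) (hne : U.Nonempty)
    (hUΩ : U ⊆ Ω) {p : Euc d → Prop} (hp : ∀ᵐ z ∂(volume.restrict Ω), p z) : ∃ z ∈ U, p z := by
  by_contra! h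
  have h1 : volume.restrict Ω U = 0 := measure_mono_null (fun z hz => h z hz) hp
  rw [Measure.restrict_apply hU.measurableSet, inter_eq_left.2 hUΩ] at h1
  exact hU.measure_ne_zero volume hne h1

/-- Chaining: if `w` oscillates by at most `A` between almost all pairs of points at distance less
than `r`, then its oscillation at distance less than `(k + 1) * r` is at most `(k + 2) * A`. -/
lemma abs_sub_le_of_chain {Ω B G : Set (Euc d)} {w : Euc d → ℝ} {r A : ℝ} (hr : 0 < r)
    (hB : IsOpen B) (hBc : Convex ℝ B) (hBΩ : B ⊆ Ω)
    (hG : ∀ x ∈ G, ∀ᵐ y ∂(volume.restrict Ω), dist x y < r → |w x - w y| ≤ A)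
    (hGae : ∀ᵐ y ∂(volume.restrict Ω), y ∈ G) (k : ℕ) :
    ∀ x ∈ G ∩ B, ∀ y ∈ G ∩ B, dist x y < (k + 1) * r → |w x - w y| ≤ (k + 2) * A := by
  induction k with
  | zero =>
    rintro x ⟨hxG, hxB⟩ y ⟨hyG, hyB⟩ hxy
    obtain ⟨z, ⟨⟨hz1, hz2⟩, -⟩, h1, h2⟩ := exists_mem_of_ae_restrict
      (U := Metric.ball x r ∩ Metric.ball y r ∩ B)
      ((Metric.isOpen_ball.inter Metric.isOpen_ball).inter hB)
      ⟨y, ⟨by simpa [dist_comm] using hxy, by simpa using hr⟩, hyB⟩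
      (inter_subset_right.trans hBΩ) ((hG x hxG).and (hG y hyG))
    have h1 := h1 (by rw [dist_comm]; exact hz1)
    have h2 := h2 (by rw [dist_comm]; exact hz2)
    have := abs_sub_le (w x) (w z) (w y)
    rw [abs_sub_comm (w z)] at this
    push_cast
    linarith
  | succ k ih =>
    rintro x ⟨hxG, hxB⟩ y ⟨hyG, hyB⟩ hxy
    push_cast at hxy
    have hk : (0 : ℝ) < k + 2 := by positivity
    have hd : dist x y / (k + 2) < r := by
      rw [div_lt_iff₀ hk]; linarith
    have hsplit : dist x y = dist x y / (k + 2) + (k + 1) * (dist x y / (k + 2)) := by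
      field_simp; ring
    obtain ⟨z, ⟨⟨hz1, hz2⟩, hzB⟩, h1, hzG⟩ := exists_mem_of_ae_restrict
      (U := Metric.ball x r ∩ Metric.ball y ((k + 1) * r) ∩ B)
      ((Metric.isOpen_ball.inter Metric.isOpen_ball).inter hB)
      ⟨AffineMap.lineMap x y (1 / (k + 2 : ℝ)), ⟨by
        rw [Metric.mem_ball, dist_lineMap_left, Real.norm_of_nonneg (by positivity)]
        calc _ = dist x y / (k + 2) := by ring
          _ < r := hd, by
        rw [Metric.mem_ball, dist_lineMap_right]
        have : 1 - 1 / (k + 2 : ℝ) = (k + 1) / (k + 2) := by field_simp; ring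
        rw [this, Real.norm_of_nonneg (by positivity)]
        calc _ = (k + 1) * (dist x y / (k + 2)) := by ring
          _ < (k + 1) * r := by gcongr⟩,
        hBc.lineMap_mem hxB hyB ⟨by positivity, by rw [div_le_one hk]; linarith⟩⟩
      (inter_subset_right.trans hBΩ) ((hG x hxG).and hGae)
    have h1 := h1 (by rw [dist_comm]; exact hz1)
    have h2 := ih z ⟨hzG, hzB⟩ y ⟨hyG, hyB⟩ hz2
    have := abs_sub_le (w x) (w z) (w y)
    push_cast
    linarith

lemma ae_ae_abs_sub_le_of_Fnl_le {Ω : Set (Euc d)} {η : ℝ → ℝ} {c : ℝ} (hη : IsKernel η c)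
    {s t L : ℝ} (hs : 0 < s) (ht : 0 < η t) (hL : 0 ≤ L) {w : Euc d → ℝ}
    (hw : Fnl Ω η s w ≤ ENNReal.ofReal L) :
    ∀ᵐ x ∂(volume.restrict Ω), ∀ᵐ y ∂(volume.restrict Ω),
      dist x y < s * t → |w x - w y| ≤ L * s / η t := by
  apply Measure.ae_ae_of_ae_prod
    (p := fun q : Euc d × Euc d => dist q.1 q.2 < s * t → |w q.1 - w q.2| ≤ L * s / η t)
  filter_upwards [ENNReal.ae_le_essSup (μ := (volume.restrict Ω).prod (volume.restrict Ω))
    fun q : Euc d × Euc d => ENNReal.ofReal (η (dist q.1 q.2 / s) * |w q.1 - w q.2|)] with q hq hd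
  have h1 : ENNReal.ofReal (1 / s * (η (dist q.1 q.2 / s) * |w q.1 - w q.2|)) ≤
      ENNReal.ofReal L := by
    rw [ENNReal.ofReal_mul (by positivity)]
    exact (mul_le_mul_right hq _).trans hw
  rw [ENNReal.ofReal_le_ofReal_iff hL] at h1
  have h0 : 0 ≤ dist q.1 q.2 / s := by positivity
  have h2 : dist q.1 q.2 / s ≤ t := by rw [div_le_iff₀ hs]; linarith
  have h3 : η t ≤ η (dist q.1 q.2 / s) := hη.antitone h0 (h0.trans h2) h2
  rw [le_div_iff₀ ht]
  rw [one_div, inv_mul_le_iff₀ hs] at h1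
  calc |w q.1 - w q.2| * η t = η t * |w q.1 - w q.2| := mul_comm _ _
    _ ≤ _ := mul_le_mul_of_nonneg_right h3 (abs_nonneg _)
    _ ≤ _ := h1.trans_eq (mul_comm _ _)

/-- A function that is `M`-Lipschitz on a conull part of every ball inside `Ω` has a
representative that is `M`-Lipschitz on every ball inside `Ω`. -/
lemma Floc_le_of_lipschitzOnWith {Ω G : Set (Euc d)} (hΩ : IsOpen Ω) {u : Euc d → ℝ} {M : NNReal}
    (hG : ∀ᵐ x ∂(volume.restrict Ω), x ∈ G)
    (hu : ∀ x r, Metric.ball x r ⊆ Ω → LipschitzOnWith M u (G ∩ Metric.ball x r)) :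
    Floc Ω u ≤ M := by
  set v : Euc d → ℝ := fun x => limUnder (𝓝[G] x) u
  have key : ∀ x r, Metric.ball x r ⊆ Ω →
      ∃ g, LipschitzWith M g ∧ EqOn u g (G ∩ Metric.ball x r) ∧ EqOn v g (Metric.ball x r) := by
    intro x r hxr
    obtain ⟨g, hg, hgu⟩ := (hu x r hxr).extend_real
    refine ⟨g, hg, hgu, fun y hy => ?_⟩
    have : (𝓝[G] y).NeBot := by
      rw [← mem_closure_iff_nhdsWithin_neBot, mem_closure_iff]
      intro U hU hyU
      obtain ⟨z, hz, hzG⟩ := exists_mem_of_ae_restrict (hU.inter Metric.isOpen_ball) ⟨y, hyU, hy⟩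
        (inter_subset_right.trans hxr) hG
      exact ⟨z, hz.1, hzG⟩
    apply Tendsto.limUnder_eq
    refine (hg.continuous.continuousAt.mono_left nhdsWithin_le_nhds :
      Tendsto g (𝓝[G] y) (𝓝 (g y))).congr' ?_
    filter_upwards [self_mem_nhdsWithin,
      mem_nhdsWithin_of_mem_nhds (Metric.isOpen_ball.mem_nhds hy)] with z hz1 hz2
    exact (hgu ⟨hz1, hz2⟩).symm
  have hvL : ∀ x r, Metric.ball x r ⊆ Ω → LipschitzOnWith M v (Metric.ball x r) := by
    intro x r hxr
    obtain ⟨g, hg, -, hvg⟩ := key x r hxr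
    intro a ha b hb
    rw [hvg ha, hvg hb]
    exact hg a b
  have huv : u =ᵐ[volume.restrict Ω] v := by
    filter_upwards [hG, ae_restrict_mem hΩ.measurableSet] with x hxG hxΩ
    obtain ⟨r, hr, hxr⟩ := Metric.isOpen_iff.1 hΩ x hxΩ
    obtain ⟨g, -, hug, hvg⟩ := key x r hxr
    have hx := Metric.mem_ball_self (x := x) hr
    rw [hug ⟨hxG, hx⟩, hvg hx]
  have hloc : LocLipOn Ω v := by
    intro x hx
    obtain ⟨r, hr, hxr⟩ := Metric.isOpen_iff.1 hΩ x hx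
    exact ⟨r, hr, M, (hvL x r hxr).mono inter_subset_left⟩
  refine (iInf₂_le v huv).trans ((iInf_le _ hloc).trans ?_)
  refine essSup_le_of_ae_le _ ?_
  filter_upwards [ae_restrict_mem hΩ.measurableSet] with x hx
  obtain ⟨r, hr, hxr⟩ := Metric.isOpen_iff.1 hΩ x hx
  have := norm_fderiv_le_of_lipschitzOn ℝ (Metric.ball_mem_nhds x hr) (hvL x r hxr)
  exact_mod_cast this

lemma ofReal_mul_Floc_le {Ω : Set (Euc d)} (hΩ : IsOpen Ω) {η : ℝ → ℝ} {c : ℝ}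
    (hη : IsKernel η c) {s : ℕ → ℝ} (hs : ∀ n, 0 < s n) (hs0 : Tendsto s atTop (𝓝 0))
    {u : Euc d → ℝ} {un : ℕ → Euc d → ℝ} (hun : TendstoLinf Ω un u) {L : ℝ} (hL : 0 ≤ L)
    (hfreq : ∃ᶠ n in atTop, Fnl Ω η (s n) (un n) ≤ ENNReal.ofReal L) {t : ℝ} (ht : 0 ≤ t) :
    ENNReal.ofReal (η t * t) * Floc Ω u ≤ ENNReal.ofReal L := by
  rcases ht.eq_or_lt with rfl | ht
  · simp
  rcases (hη.nonneg t).eq_or_lt with h0 | hηt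
  · simp [← h0]
  have hp : 0 < η t * t := mul_pos hηt ht
  set G : Set (Euc d) := {x | ∀ n,
    (‖un n x - u x‖₊ : ℝ≥0∞) ≤ einfNorm Ω (fun x => un n x - u x)}
  set H : ℕ → Set (Euc d) := fun n => {x | Fnl Ω η (s n) (un n) ≤ ENNReal.ofReal L →
    ∀ᵐ y ∂(volume.restrict Ω), dist x y < s n * t → |un n x - un n y| ≤ L * s n / η t}
  have hG : ∀ᵐ x ∂(volume.restrict Ω), x ∈ G := ae_all_iff.2 fun n => ENNReal.ae_le_essSup _
  have hH : ∀ n, ∀ᵐ x ∂(volume.restrict Ω), x ∈ H n := by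
    intro n
    by_cases hn : Fnl Ω η (s n) (un n) ≤ ENNReal.ofReal L
    · filter_upwards [ae_ae_abs_sub_le_of_Fnl_le hη (hs n) hηt hL hn] with x hx _ using hx
    · exact Eventually.of_forall fun x h => absurd h hn
  have hM : 0 ≤ L / (η t * t) := by positivity
  have hF : Floc Ω u ≤ ENNReal.ofReal (L / (η t * t)) := by
    refine Floc_le_of_lipschitzOnWith hΩ (G := G ∩ ⋂ n, H n) ?_ ?_
    · filter_upwards [hG, ae_all_iff.2 hH] with x h1 h2 using ⟨h1, mem_iInter.2 h2⟩
    intro a r har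
    refine LipschitzOnWith.of_dist_le_mul ?_
    rintro x ⟨⟨hxG, hxH⟩, hxB⟩ y ⟨⟨hyG, hyH⟩, hyB⟩
    rw [mem_iInter] at hxH hyH
    set e : ℕ → ℝ := fun n => (einfNorm Ω (fun x => un n x - u x)).toReal
    have he0 : Tendsto e atTop (𝓝 0) := by
      exact (ENNReal.tendsto_toReal ENNReal.zero_ne_top).comp hun
    have hlim : Tendsto (fun n => 2 * e n + (dist x y / (s n * t) + 2) * (L * s n / η t)) atTop
        (𝓝 (2 * 0 + (L / (η t * t) * dist x y + 2 * (L * 0 / η t)))) := by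
      have : Tendsto (fun n => 2 * e n + (L / (η t * t) * dist x y + 2 * (L * s n / η t))) atTop
        (𝓝 (2 * 0 + (L / (η t * t) * dist x y + 2 * (L * 0 / η t)))) :=
        (he0.const_mul 2).add (((hs0.const_mul L).div_const _).const_mul 2 |>.const_add _)
      refine this.congr fun n => ?_
      have := (hs n).ne'
      field_simp
    have hfin : ∀ᶠ n in atTop, einfNorm Ω (fun x => un n x - u x) < ⊤ :=
      hun.eventually (gt_mem_nhds ENNReal.zero_lt_top)
    have hgoal := ge_of_tendsto_of_frequently hlim (b := |u x - u y|) ?_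
    · rw [Real.coe_toNNReal _ hM]
      simpa [Real.dist_eq] using hgoal
    refine (hfreq.and_eventually hfin).mono ?_
    rintro n ⟨hn, hfn⟩
    have hux : ∀ z ∈ G, |un n z - u z| ≤ e n := by
      intro z hz
      have := ENNReal.toReal_mono hfn.ne (hz n)
      simpa using this
    have h1 := hux x hxG
    have h2 := hux y hyG
    have hst : 0 < s n * t := mul_pos (hs n) ht
    have h3 := abs_sub_le_of_chain hst Metric.isOpen_ball (convex_ball a r) har
      (G := H n) (w := un n) (A := L * s n / η t) (fun z hz => hz hn) (hH n)
      ⌊dist x y / (s n * t)⌋₊ x ⟨hxH n, hxB⟩ y ⟨hyH n, hyB⟩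
      (by rw [← div_lt_iff₀ hst]; exact Nat.lt_floor_add_one _)
    have h4 : (⌊dist x y / (s n * t)⌋₊ + 2 : ℝ) * (L * s n / η t) ≤
        (dist x y / (s n * t) + 2) * (L * s n / η t) := by
      have := Nat.floor_le (a := dist x y / (s n * t)) (by positivity)
      have := (hs n).le
      gcongr
    rw [abs_le] at h1 h2 h3 ⊢
    constructor <;> linarith [h1.1, h1.2, h2.1, h2.2, h3.1, h3.2]
  calc ENNReal.ofReal (η t * t) * Floc Ω u
      ≤ ENNReal.ofReal (η t * t) * ENNReal.ofReal (L / (η t * t)) := by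
        gcongr
    _ = ENNReal.ofReal L := by
        rw [← ENNReal.ofReal_mul hp.le, mul_div_cancel₀ _ hp.ne']

/-- Mean value inequality for a Lipschitz function whose gradient is bounded almost everywhere. -/
lemma abs_sub_le_of_ae_norm_fderiv_le {B : Set (Euc d)} (hB : IsOpen B) (hBc : Convex ℝ B)
    {g : Euc d → ℝ} {K : NNReal} (hg : LipschitzWith K g) {M : ℝ}
    (hM : ∀ᵐ z ∂(volume.restrict B), ‖fderiv ℝ g z‖ ≤ M) {x y : Euc d} (hx : x ∈ B) (hy : y ∈ B) :
    |g x - g y| ≤ M * dist x y := by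
  obtain ⟨a, ha, hax⟩ := Metric.isOpen_iff.1 hB x hx
  obtain ⟨b, hb, hby⟩ := Metric.isOpen_iff.1 hB y hy
  set h := y - x with hh
  have hdist : dist x y = ‖h‖ := by rw [dist_comm, dist_eq_norm]
  have main : ∀ ρ, 0 < ρ → ρ ≤ a → ρ ≤ b → |g x - g y| ≤ M * dist x y + 2 * K * ρ := by
    intro ρ hρ hρa hρb
    set S := Metric.ball x ρ
    have hSfin : volume S < ⊤ := Metric.isBounded_ball.measure_lt_top
    have hSpos : 0 < volume.real S :=
      ENNReal.toReal_pos (Metric.isOpen_ball.measure_ne_zero volume ⟨x, Metric.mem_ball_self hρ⟩)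
        hSfin.ne
    have hint : ∀ f : Euc d → ℝ, Continuous f → IntegrableOn f S := fun f hf =>
      (hf.continuousOn.integrableOn_compact (isCompact_closedBall x ρ)).mono_set
        Metric.ball_subset_closedBall
    have hmem : ∀ z ∈ S, ∀ t ∈ Icc (0 : ℝ) 1, z + t • h ∈ B := by
      intro z hz t ht
      have h1 : z ∈ B := hax (Metric.ball_subset_ball hρa hz)
      have h2 : z + h ∈ B := by
        apply hby
        rw [Metric.mem_ball, dist_eq_norm]
        have : z + h - y = z - x := by rw [hh]; abel
        rw [this, ← dist_eq_norm]
        exact lt_of_lt_of_le hz hρb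
      have := hBc.add_smul_sub_mem h1 h2 ht
      simpa using this
    have hcont : ∀ t : ℝ, Continuous fun z => g (z + t • h) := fun t =>
      hg.continuous.comp (continuous_id.add continuous_const)
    have hshift : ∀ (t : ℝ) {p : Euc d → Prop}, (∀ᵐ z ∂volume, p z) →
        ∀ᵐ z ∂volume, p (z + t • h) := fun t p hp =>
      (measurePreserving_add_right volume (t • h)).quasiMeasurePreserving.ae hp
    have hder : ∀ t : ℝ, HasDerivAt (fun t : ℝ => ∫ z in S, g (z + t • h))
        (∫ z in S, fderiv ℝ g (z + t • h) h) t := by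
      intro t
      refine (hasDerivAt_integral_of_dominated_loc_of_lip (bound := fun _ => K * ‖h‖) univ_mem
        (Eventually.of_forall fun t => (hcont t).aestronglyMeasurable)
        (hint _ (hcont t)) ?_ ?_ ?_ ?_).2
      · exact ((measurable_fderiv_apply_const ℝ g h).comp
          (measurable_id.add_const _)).aestronglyMeasurable
      · refine Eventually.of_forall fun z => LipschitzOnWith.of_dist_le_mul fun p _ q _ => ?_
        refine (hg.dist_le_mul _ _).trans_eq ?_
        rw [dist_add_left, dist_eq_norm, ← sub_smul, norm_smul, Real.dist_eq, Real.coe_nnabs,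
          abs_of_nonneg (by positivity), Real.norm_eq_abs]
        ring
      · exact hint _ continuous_const
      · filter_upwards [ae_restrict_of_ae (hshift t (hg.ae_differentiableAt (μ := volume)))]
          with z hz
        have h2 : HasDerivAt (fun t : ℝ => z + t • h) h t := by
          simpa using ((hasDerivAt_id t).smul_const h).const_add z
        exact hz.hasFDerivAt.comp_hasDerivAt t h2
    have hmvt := norm_image_sub_le_of_norm_deriv_le_segment_01'
      (f := fun t : ℝ => ∫ z in S, g (z + t • h)) (C := M * ‖h‖ * volume.real S)
      (fun t _ => (hder t).hasDerivWithinAt) (by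
        intro t ht
        refine norm_setIntegral_le_of_norm_le_const_ae' hSfin ?_
        filter_upwards [hshift t ((ae_restrict_iff' hB.measurableSet).1 hM)] with z hz hzS
        exact (ContinuousLinearMap.le_opNorm _ _).trans
          (mul_le_mul_of_nonneg_right (hz (hmem z hzS t ⟨ht.1, ht.2.le⟩)) (norm_nonneg _)))
    have herr : ‖∫ z in S, ((g (z + h) - g z) - (g y - g x))‖ ≤ 2 * K * ρ * volume.real S := by
      refine norm_setIntegral_le_of_norm_le_const hSfin fun z hz => ?_
      have hz : dist z x ≤ ρ := (Metric.mem_ball.1 hz).le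
      have h1 : |g (z + h) - g y| ≤ K * ρ := by
        refine (hg.dist_le_mul _ _).trans ?_
        have : dist (z + h) y = dist z x := by
          rw [dist_eq_norm, dist_eq_norm, hh]; congr 1; abel
        rw [this]; gcongr
      have h2 : |g z - g x| ≤ K * ρ := (hg.dist_le_mul _ _).trans (by gcongr)
      rw [Real.norm_eq_abs]
      rw [abs_le] at h1 h2 ⊢
      constructor <;> linarith [h1.1, h1.2, h2.1, h2.2]
    have hc1 : Continuous fun z => g (z + h) := by simpa using hcont 1
    have heq : ∫ z in S, ((g (z + h) - g z) - (g y - g x)) =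
        ((∫ z in S, g (z + h)) - ∫ z in S, g z) - volume.real S * (g y - g x) := by
      rw [integral_sub (hint (fun z => g (z + h) - g z) (hc1.sub hg.continuous))
          (hint _ continuous_const),
        integral_sub (hint _ hc1) (hint _ hg.continuous),
        setIntegral_const, smul_eq_mul]
    rw [heq] at herr
    simp only [one_smul, zero_smul, add_zero] at hmvt
    have h5 : volume.real S * |g x - g y| ≤ volume.real S * (M * dist x y + 2 * K * ρ) := by
      rw [hdist, ← abs_of_pos hSpos, ← abs_mul, abs_of_pos hSpos]
      rw [Real.norm_eq_abs, abs_le] at herr hmvt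
      rw [abs_le]
      constructor <;> linarith [herr.1, herr.2, hmvt.1, hmvt.2]
    exact le_of_mul_le_mul_left h5 hSpos
  have hlim : Tendsto (fun ρ : ℝ => M * dist x y + 2 * K * ρ) (𝓝[>] 0)
      (𝓝 (M * dist x y + 2 * K * 0)) :=
    ((continuous_const.add (continuous_const.mul continuous_id)).tendsto 0).mono_left
      nhdsWithin_le_nhds
  rw [mul_zero, add_zero] at hlim
  refine ge_of_tendsto hlim ?_
  filter_upwards [Ioo_mem_nhdsGT (lt_min ha hb)] with ρ hρ
  exact main ρ hρ.1 (hρ.2.le.trans (min_le_left _ _)) (hρ.2.le.trans (min_le_right _ _))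

lemma exists_lipschitzOnWith_ball_of_gradSup_le {Ω : Set (Euc d)} (hΩ : IsOpen Ω) {v : Euc d → ℝ}
    (hv : LocLipOn Ω v) {M : NNReal} (hM : gradSup Ω v ≤ M) {x : Euc d} (hx : x ∈ Ω) :
    ∃ r > 0, LipschitzOnWith M v (Metric.ball x r) := by
  obtain ⟨ε, hε, K, hK⟩ := hv x hx
  obtain ⟨r, hr, hxr⟩ := Metric.isOpen_iff.1 hΩ x hx
  have hBΩ : Metric.ball x (min ε r) ⊆ Ω :=
    (Metric.ball_subset_ball (min_le_right _ _)).trans hxr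
  have hK : LipschitzOnWith K v (Metric.ball x (min ε r)) :=
    hK.mono (subset_inter (Metric.ball_subset_ball (min_le_left _ _)) hBΩ)
  obtain ⟨g, hg, hvg⟩ := hK.extend_real
  refine ⟨min ε r, lt_min hε hr, LipschitzOnWith.of_dist_le_mul fun a ha b hb => ?_⟩
  rw [hvg ha, hvg hb]
  refine abs_sub_le_of_ae_norm_fderiv_le Metric.isOpen_ball (convex_ball _ _) hg ?_ ha hb
  have h1 : ∀ᵐ z ∂(volume.restrict Ω), ‖fderiv ℝ v z‖ ≤ M := by
    filter_upwards [ENNReal.ae_le_essSup (μ := volume.restrict Ω)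
      fun z => (‖fderiv ℝ v z‖₊ : ℝ≥0∞)] with z hz
    exact_mod_cast hz.trans hM
  filter_upwards [ae_restrict_of_ae_restrict_of_subset hBΩ h1,
    ae_restrict_mem Metric.isOpen_ball.measurableSet] with z hz hzB
  rwa [← (hvg.eventuallyEq_of_mem (Metric.isOpen_ball.mem_nhds hzB)).fderiv_eq]

lemma edist_le_mul_eVariationOn {Ω : Set (Euc d)} {v : Euc d → ℝ} {M : NNReal}
    (hv : ∀ x ∈ Ω, ∃ r > 0, LipschitzOnWith M v (Metric.ball x r)) {γ : ℝ → Euc d}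
    (hγ : ContinuousOn γ (Icc 0 1)) (hγΩ : MapsTo γ (Icc 0 1) Ω) :
    edist (v (γ 0)) (v (γ 1)) ≤ M * eVariationOn γ (Icc 0 1) := by
  choose! r hr hL using hv
  obtain ⟨t, ht0, htm, ⟨N, hN⟩, htc⟩ := exists_monotone_Icc_subset_open_cover_unitInterval
    (c := fun i : unitInterval =>
      (fun p : unitInterval => γ p) ⁻¹' Metric.ball (γ i) (r (γ i)))
    (fun i => Metric.isOpen_ball.preimage hγ.domRestrict)
    (fun i _ => mem_iUnion.2 ⟨i, Metric.mem_ball_self (hr _ (hγΩ i.2))⟩)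
  have key : ∀ n, edist (v (γ 0)) (v (γ (t n))) ≤
      M * eVariationOn γ (Icc 0 1 ∩ Icc 0 (t n : ℝ)) := by
    intro n
    induction n with
    | zero => simp [ht0]
    | succ n ih =>
      obtain ⟨i, hi⟩ := htc n
      have hle : t n ≤ t (n + 1) := htm n.le_succ
      have h1 : edist (v (γ (t n))) (v (γ (t (n + 1)))) ≤
          M * eVariationOn γ (Icc 0 1 ∩ Icc (t n : ℝ) (t (n + 1))) := by
        refine (hL _ (hγΩ i.2) (hi ⟨le_rfl, hle⟩) (hi ⟨hle, le_rfl⟩)).trans ?_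
        gcongr
        exact eVariationOn.edist_le γ ⟨(t n).2, le_rfl, hle⟩ ⟨(t (n + 1)).2, hle, le_rfl⟩
      rw [← eVariationOn.Icc_add_Icc γ (t n).2.1 (show (t n : ℝ) ≤ t (n + 1) from hle) (t n).2,
        mul_add]
      exact (edist_triangle _ _ _).trans (add_le_add ih h1)
  simpa [hN N le_rfl] using key N

lemma edist_le_mul_geoDist {Ω : Set (Euc d)} {v : Euc d → ℝ} {M : NNReal}
    (hv : ∀ x ∈ Ω, ∃ r > 0, LipschitzOnWith M v (Metric.ball x r)) {x y : Euc d} (hx : x ∈ Ω)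
    (hy : y ∈ Ω) (hfin : geoDist Ω x y ≠ ⊤) :
    edist (v x) (v y) ≤ M * geoDist Ω x y := by
  refine ENNReal.le_of_forall_pos_le_add fun ε hε _ => ?_
  obtain ⟨δ, hδ, hδε⟩ : ∃ δ : NNReal, 0 < δ ∧ M * δ ≤ ε := by
    refine ⟨ε / (M + 1), by positivity, ?_⟩
    rw [mul_div_assoc', div_le_iff₀ (by positivity), mul_comm]
    gcongr
    simp
  have hlt : geoDist Ω x y < geoDist Ω x y + δ :=
    ENNReal.lt_add_right hfin (by exact_mod_cast hδ.ne')
  conv_lhs at hlt => rw [geoDist]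
  simp only [iInf_lt_iff] at hlt
  obtain ⟨γ, hγ, hγΩ, h0, h1, hlen⟩ := hlt
  have hmaps : MapsTo γ (Icc 0 1) Ω := by
    intro t ht
    rcases ht.1.eq_or_lt with rfl | h0t
    · rwa [h0]
    rcases ht.2.eq_or_lt with rfl | h1t
    · rwa [h1]
    exact hγΩ ⟨h0t, h1t⟩
  calc edist (v x) (v y) = edist (v (γ 0)) (v (γ 1)) := by rw [h0, h1]
    _ ≤ M * eVariationOn γ (Icc 0 1) := edist_le_mul_eVariationOn hv hγ hmaps
    _ ≤ M * (geoDist Ω x y + δ) := by gcongr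
    _ = M * geoDist Ω x y + (M * δ : NNReal) := by push_cast; ring
    _ ≤ M * geoDist Ω x y + ε := by gcongr

lemma ofReal_mul_self_le_sigmaEta {η : ℝ → ℝ} {c : ℝ} (hη : IsKernel η c) {t : ℝ} (ht : 0 ≤ t) :
    ENNReal.ofReal (η t * t) ≤ sigmaEta η := by
  rcases ht.eq_or_lt with rfl | ht
  · simp
  have hlim : Tendsto (fun r => ENNReal.ofReal (η t * r)) (𝓝[<] t)
      (𝓝 (ENNReal.ofReal (η t * t))) :=
    ((ENNReal.continuous_ofReal.comp (continuous_const.mul continuous_id)).tendsto t).mono_left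
      nhdsWithin_le_nhds
  refine le_of_tendsto_of_frequently hlim ?_
  intro hev
  have hev : ∀ᶠ r in 𝓝[<] t, ¬ ENNReal.ofReal (η t * r) ≤ sigmaEta η := hev
  obtain ⟨l, hl, hlt⟩ := (mem_nhdsLT_iff_exists_Ioo_subset' ht).1 hev
  have hae := ENNReal.ae_le_essSup (μ := volume.restrict (Ici (0 : ℝ)))
    fun t => ENNReal.ofReal (η t * t)
  have hsub : Ioo (max l 0) t ⊆ Ici 0 := fun r hr => (le_max_right l 0).trans hr.1.le
  have hzero : volume (Ioo (max l 0) t) = 0 := by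
    have hae := ae_restrict_of_ae_restrict_of_subset hsub hae
    have hfalse : ∀ᵐ r ∂(volume.restrict (Ioo (max l 0) t)), False := by
      filter_upwards [hae, ae_restrict_mem measurableSet_Ioo] with r hr hrm
      have hr0 : 0 ≤ r := hsub hrm
      refine hlt ⟨(le_max_left l 0).trans_lt hrm.1, hrm.2⟩ (le_trans ?_ hr)
      gcongr
      exact hη.antitone hr0 ht.le hrm.2.le
    rw [ae_iff] at hfalse
    simpa only [not_false_eq_true, ofPred_true, Measure.restrict_apply_univ] using hfalse
  rw [Real.volume_Ioo] at hzero
  have : max l 0 < t := max_lt hl ht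
  simp only [ENNReal.ofReal_eq_zero] at hzero
  linarith

lemma sigmaEta_ne_zero {η : ℝ → ℝ} {c : ℝ} (hη : IsKernel η c) : sigmaEta η ≠ 0 := by
  have h1 : ∀ᶠ t in 𝓝[>] (0 : ℝ), 0 < η t :=
    (hη.cont_zero.eventually (lt_mem_nhds hη.pos_zero)).filter_mono nhdsWithin_le_nhds
  obtain ⟨t, ht, ht0⟩ := (h1.and self_mem_nhdsWithin).exists
  have ht0 : 0 < t := ht0
  have := ofReal_mul_self_le_sigmaEta hη ht0.le
  exact (lt_of_lt_of_le (ENNReal.ofReal_pos.2 (mul_pos ht ht0)) this).ne'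

lemma sigmaEta_ne_top {η : ℝ → ℝ} {c : ℝ} (hη : IsKernel η c) : sigmaEta η ≠ ⊤ := by
  refine ne_top_of_le_ne_top (ENNReal.ofReal_ne_top (r := η 0 * c)) (essSup_le_of_ae_le _ ?_)
  filter_upwards [ae_restrict_mem measurableSet_Ici] with t ht
  have ht : 0 ≤ t := ht
  refine ENNReal.ofReal_le_ofReal ?_
  rcases le_or_gt t c with htc | htc
  · exact mul_le_mul (hη.antitone (mem_Ici.2 le_rfl) ht ht) htc ht (hη.nonneg 0)
  · rw [hη.compact_supp t htc, zero_mul]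
    exact mul_nonneg (hη.nonneg 0) hη.c_pos.le

lemma Fnl_congr_ae {Ω : Set (Euc d)} {η : ℝ → ℝ} {s : ℝ} {u v : Euc d → ℝ}
    (huv : u =ᵐ[volume.restrict Ω] v) : Fnl Ω η s u = Fnl Ω η s v := by
  unfold Fnl
  congr 1
  refine essSup_congr_ae ?_
  filter_upwards [Measure.quasiMeasurePreserving_fst.ae huv,
    Measure.quasiMeasurePreserving_snd.ae huv] with q h1 h2
  rw [h1, h2]

lemma eventually_Fnl_le {Ω : Set (Euc d)} (hΩ : IsOpen Ω) (hD : condD Ω) {η : ℝ → ℝ} {c : ℝ}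
    (hη : IsKernel η c) {s : ℕ → ℝ} (hs : ∀ n, 0 < s n) (hs0 : Tendsto s atTop (𝓝 0))
    {v : Euc d → ℝ} (hv : LocLipOn Ω v) {M : NNReal} (hM : gradSup Ω v ≤ M) {ε : ℝ} (hε : 0 < ε) :
    ∀ᶠ n in atTop, Fnl Ω η (s n) v ≤ ENNReal.ofReal (1 + ε) * (sigmaEta η * M) := by
  have hloc : ∀ x ∈ Ω, ∃ r > 0, LipschitzOnWith M v (Metric.ball x r) :=
    fun x hx => exists_lipschitzOnWith_ball_of_gradSup_le hΩ hv hM hx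
  obtain ⟨δ, hδ, hδD⟩ := hD ε hε
  filter_upwards [hs0.eventually (gt_mem_nhds (div_pos hδ hη.c_pos))] with n hn
  have hsn := hs n
  have hcs : c * s n < δ := by rw [lt_div_iff₀ hη.c_pos] at hn; linarith
  have hess : ∀ᵐ q ∂((volume.restrict Ω).prod (volume.restrict Ω)),
      ENNReal.ofReal (η (dist q.1 q.2 / s n) * |v q.1 - v q.2|) ≤
        ENNReal.ofReal (s n) * (ENNReal.ofReal (1 + ε) * (sigmaEta η * M)) := by
    filter_upwards [Measure.quasiMeasurePreserving_fst.ae (ae_restrict_mem hΩ.measurableSet),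
      Measure.quasiMeasurePreserving_snd.ae (ae_restrict_mem hΩ.measurableSet)] with q hx hy
    set τ := dist q.1 q.2 / s n with hτ
    have hτ0 : 0 ≤ τ := by positivity
    have hdist : dist q.1 q.2 = τ * s n := by rw [hτ]; field_simp
    rcases lt_or_ge c τ with hcτ | hcτ
    · simp [hη.compact_supp τ hcτ]
    have hlt : dist q.1 q.2 < δ := by
      rw [hdist]; exact (mul_le_mul_of_nonneg_right hcτ hsn.le).trans_lt hcs
    have hgeo := hδD _ hx _ hy hlt
    have h1 : ENNReal.ofReal |v q.1 - v q.2| ≤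
        M * ENNReal.ofReal ((1 + ε) * (τ * s n)) := by
      rw [← Real.dist_eq, ← edist_dist, ← hdist]
      exact (edist_le_mul_geoDist hloc hx hy (ne_top_of_le_ne_top ENNReal.ofReal_ne_top hgeo)).trans
        (mul_le_mul_right hgeo _)
    calc ENNReal.ofReal (η τ * |v q.1 - v q.2|)
        = ENNReal.ofReal (η τ) * ENNReal.ofReal |v q.1 - v q.2| :=
          ENNReal.ofReal_mul (hη.nonneg τ)
      _ ≤ ENNReal.ofReal (η τ) * (M * ENNReal.ofReal ((1 + ε) * (τ * s n))) := by gcongr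
      _ = ENNReal.ofReal (s n) * (ENNReal.ofReal (1 + ε) * (ENNReal.ofReal (η τ * τ) * M)) := by
          rw [ENNReal.ofReal_mul (by positivity), ENNReal.ofReal_mul hτ0,
            ENNReal.ofReal_mul (hη.nonneg τ)]
          ring
      _ ≤ _ := by
          gcongr
          exact ofReal_mul_self_le_sigmaEta hη hτ0
  calc Fnl Ω η (s n) v
      ≤ ENNReal.ofReal (1 / s n) *
          (ENNReal.ofReal (s n) * (ENNReal.ofReal (1 + ε) * (sigmaEta η * M))) :=
        mul_le_mul_right (essSup_le_of_ae_le _ hess) _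
    _ = _ := by
        rw [← mul_assoc, ← ENNReal.ofReal_mul (by positivity), one_div_mul_cancel hsn.ne',
          ENNReal.ofReal_one, one_mul]

lemma limsup_Fnl_le {Ω : Set (Euc d)} (hΩ : IsOpen Ω) (hD : condD Ω) {η : ℝ → ℝ} {c : ℝ}
    (hη : IsKernel η c) {s : ℕ → ℝ} (hs : ∀ n, 0 < s n) (hs0 : Tendsto s atTop (𝓝 0))
    {v : Euc d → ℝ} (hv : LocLipOn Ω v) :
    limsup (fun n => Fnl Ω η (s n) v) atTop ≤ sigmaEta η * gradSup Ω v := by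
  rcases eq_or_ne (gradSup Ω v) ⊤ with htop | hfin
  · simp [htop, ENNReal.mul_top (sigmaEta_ne_zero hη)]
  lift gradSup Ω v to NNReal using hfin with M hM
  have hlim : Tendsto (fun ε : ℝ => ENNReal.ofReal (1 + ε) * (sigmaEta η * M)) (𝓝[>] 0)
      (𝓝 (ENNReal.ofReal (1 + 0) * (sigmaEta η * M))) := by
    refine ENNReal.Tendsto.mul_const ?_
      (Or.inr (ENNReal.mul_ne_top (sigmaEta_ne_top hη) ENNReal.coe_ne_top))
    exact ((ENNReal.continuous_ofReal.comp (continuous_const.add continuous_id)).tendsto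
      0).mono_left nhdsWithin_le_nhds
  rw [add_zero, ENNReal.ofReal_one, one_mul] at hlim
  refine ge_of_tendsto hlim ?_
  filter_upwards [self_mem_nhdsWithin] with ε hε
  exact limsup_le_of_le (h := eventually_Fnl_le hΩ hD hη hs hs0 hv hM.ge hε)

/-- Non-local to local Γ-convergence of `F_{s_n}` to `σ_η · F` in `L^∞(Ω)`. -/
theorem statement_4 {d : ℕ} (Ω : Set (Euc d)) (hΩo : IsOpen Ω) (hΩc : IsConnected Ω)
    (hΩb : Bornology.IsBounded Ω) (hD : condD Ω)
    (η : ℝ → ℝ) (c : ℝ) (hη : IsKernel η c)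
    (s : ℕ → ℝ) (hs : ∀ n, 0 < s n) (hs0 : Filter.Tendsto s Filter.atTop (nhds 0)) :
    (∀ (u : Euc d → ℝ) (un : ℕ → Euc d → ℝ), einfNorm Ω u ≠ ⊤ → (∀ n, einfNorm Ω (un n) ≠ ⊤) →
      TendstoLinf Ω un u →
      sigmaEta η * Floc Ω u ≤ Filter.liminf (fun n => Fnl Ω η (s n) (un n)) Filter.atTop) ∧
    (∀ u : Euc d → ℝ, einfNorm Ω u ≠ ⊤ →
      ∃ un : ℕ → Euc d → ℝ, TendstoLinf Ω un u ∧
        Filter.limsup (fun n => Fnl Ω η (s n) (un n)) Filter.atTop ≤ sigmaEta η * Floc Ω u) := by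
  refine ⟨fun u un _ _ hun => ?_, fun u _ => ⟨fun _ => u, ?_, ?_⟩⟩
  · refine le_of_forall_gt_imp_ge_of_dense fun L hL => ?_
    rcases eq_or_ne L ⊤ with rfl | hLtop
    · exact le_top
    rw [← ENNReal.ofReal_toReal hLtop]
    have hfreq : ∃ᶠ n in atTop, Fnl Ω η (s n) (un n) ≤ ENNReal.ofReal L.toReal := by
      rw [ENNReal.ofReal_toReal hLtop]
      exact (frequently_lt_of_liminf_lt (h := hL)).mono fun n hn => hn.le
    have hkey : ∀ t, 0 ≤ t → ENNReal.ofReal (η t * t) * Floc Ω u ≤ ENNReal.ofReal L.toReal :=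
      fun t ht => ofReal_mul_Floc_le hΩo hη hs hs0 hun ENNReal.toReal_nonneg hfreq ht
    have hσ : sigmaEta η ≤ ⨆ t : Ici (0 : ℝ), ENNReal.ofReal (η t * t) := by
      refine essSup_le_of_ae_le _ ?_
      filter_upwards [ae_restrict_mem measurableSet_Ici] with t ht
      exact le_iSup (fun t : Ici (0 : ℝ) => ENNReal.ofReal (η t * t)) ⟨t, ht⟩
    refine (mul_le_mul_left hσ _).trans ?_
    rw [ENNReal.iSup_mul]
    exact iSup_le fun t => hkey t t.2
  · have h0 : einfNorm Ω (fun x => u x - u x) = 0 :=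
      le_antisymm (essSup_le_of_ae_le _ (Eventually.of_forall fun x => by simp)) zero_le
    simp only [TendstoLinf, h0, tendsto_const_nhds]
  · unfold Floc
    rw [ENNReal.mul_iInf_of_ne (sigmaEta_ne_zero hη) (sigmaEta_ne_top hη)]
    refine le_iInf fun v => ?_
    rw [ENNReal.mul_iInf_of_ne (sigmaEta_ne_zero hη) (sigmaEta_ne_top hη)]
    refine le_iInf fun huv => ?_
    rw [ENNReal.mul_iInf_of_ne (sigmaEta_ne_zero hη) (sigmaEta_ne_top hη)]
    refine le_iInf fun hv => ?_
    simp only [Fnl_congr_ae huv]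
    exact limsup_Fnl_le hΩo hD hη hs hs0 hv


end
end

section
/- Let Ω ⊂ ℝ^d be an open bounded domain satisfying the geodesic condition (D), let the kernel η satisfy (K1)–(K3), and let (s_n) ⊂ (0,∞) be a null sequence with r_n/s_n → 0. Then every sequence (u_n) ⊂ L^∞(Ω) with sup_{n∈ℕ} E_{n,cons}(u_n) < ∞ is relatively compact in L^∞(Ω). -/
open MeasureTheory Filter Set Topology ENNReal

noncomputable section

variable {d : ℕ}

/-- If `w` varies by at most `A` between points of `S` at distance at most `h`, then it varies by
at most `(n + 1) * A` between the endpoints of a curve in `S` of length at most `n * h`. -/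
theorem abs_sub_le_of_eVariationOn_le {X : Type*} [PseudoMetricSpace X] {γ : ℝ → X} {w : X → ℝ}
    {S : Set X} {h A : ℝ} (hh : 0 < h)
    (hw : ∀ p ∈ S, ∀ q ∈ S, dist p q ≤ h → |w p - w q| ≤ A) {b : ℝ} (n : ℕ) :
    ∀ a ≤ b, ContinuousOn γ (Icc a b) → MapsTo γ (Icc a b) S →
      eVariationOn γ (Icc a b) ≤ ENNReal.ofReal (n * h) →
      |w (γ a) - w (γ b)| ≤ (n + 1) * A := by
  induction n with
  | zero =>
    intro a hab _ hmaps hvar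
    have hA := hw _ (hmaps (left_mem_Icc.2 hab)) _ (hmaps (right_mem_Icc.2 hab))
    have hd := (eVariationOn.edist_le γ (left_mem_Icc.2 hab) (right_mem_Icc.2 hab)).trans hvar
    rw [edist_dist, ENNReal.ofReal_le_ofReal_iff (by simp)] at hd
    push_cast at hd ⊢
    linarith [hA (by linarith)]
  | succ n ih =>
    intro a hab hcont hmaps hvar
    have haS := hmaps (left_mem_Icc.2 hab)
    have hA : 0 ≤ A := by simpa using hw _ haS _ haS (by simpa using hh.le)
    by_cases hsmall : dist (γ a) (γ b) ≤ h
    · have := hw _ haS _ (hmaps (right_mem_Icc.2 hab)) hsmall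
      push_cast
      nlinarith [mul_nonneg (n.cast_nonneg (α := ℝ)) hA]
    obtain ⟨t, ht, hdt⟩ : ∃ t ∈ Icc a b, dist (γ a) (γ t) = h := by
      have := intermediate_value_Icc hab
        (f := fun t => dist (γ a) (γ t)) (by fun_prop)
      exact this ⟨by simpa using hh.le, (not_le.1 hsmall).le⟩
    have hsplit := eVariationOn.Icc_add_Icc γ (s := univ) ht.1 ht.2 (mem_univ t)
    simp only [univ_inter] at hsplit
    have hfirst : ENNReal.ofReal h ≤ eVariationOn γ (Icc a t) := by
      rw [← hdt, ← edist_dist]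
      exact eVariationOn.edist_le γ (left_mem_Icc.2 ht.1) (right_mem_Icc.2 ht.1)
    have hlast : eVariationOn γ (Icc t b) ≤ ENNReal.ofReal (n * h) := by
      have hle : ENNReal.ofReal h + eVariationOn γ (Icc t b)
          ≤ ENNReal.ofReal h + ENNReal.ofReal (n * h) := by
        rw [← ENNReal.ofReal_add hh.le (by positivity)]
        calc _ ≤ eVariationOn γ (Icc a t) + eVariationOn γ (Icc t b) := by gcongr
          _ ≤ _ := hsplit.trans_le hvar
          _ = _ := by congr 1; push_cast; ring
      exact (ENNReal.add_le_add_iff_left ENNReal.ofReal_ne_top).1 hle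
    have hsub : Icc t b ⊆ Icc a b := Icc_subset_Icc_left ht.1
    have h₁ := hw _ haS _ (hmaps ht) hdt.le
    have h₂ := ih t ht.2 (hcont.mono hsub) (hmaps.mono_left hsub) hlast
    have h₃ := abs_sub_le (w (γ a)) (w (γ t)) (w (γ b))
    push_cast
    linarith

/-- A function varying by at most `A` at scale `h` grows at most linearly, with slope of order
`A / h`, at distances where the geodesic distance is at most twice the Euclidean one. -/
theorem abs_sub_le_of_geoDist_le {Ω : Set (Euc d)} {w : Euc d → ℝ} {h A : ℝ} (hh : 0 < h)
    (hw : ∀ p ∈ Ω, ∀ q ∈ Ω, dist p q ≤ h → |w p - w q| ≤ A) {x y : Euc d} (hx : x ∈ Ω)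
    (hy : y ∈ Ω) (hgeo : geoDist Ω x y ≤ ENNReal.ofReal (2 * dist x y)) :
    |w x - w y| ≤ (2 * dist x y / h + 3) * A := by
  have hA : 0 ≤ A := by simpa using hw _ hx _ hx (by simpa using hh.le)
  have hlt : geoDist Ω x y < ENNReal.ofReal (2 * dist x y + h) :=
    hgeo.trans_lt ((ENNReal.ofReal_lt_ofReal_iff (by positivity)).2 (by linarith))
  simp only [geoDist, iInf_lt_iff] at hlt
  obtain ⟨γ, hcont, hmaps, rfl, rfl, hvar⟩ := hlt
  have hmaps' : MapsTo γ (Icc 0 1) Ω := by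
    intro t ht
    rcases eq_or_lt_of_le ht.1 with rfl | h0
    · exact hx
    rcases eq_or_lt_of_le ht.2 with rfl | h1
    · exact hy
    exact hmaps ⟨h0, h1⟩
  set L := dist (γ 0) (γ 1)
  set n := ⌈2 * L / h + 1⌉₊
  have hL : 0 ≤ L := dist_nonneg
  have hn₁ : 2 * L / h + 1 ≤ n := Nat.le_ceil _
  have hn₂ : (n : ℝ) < 2 * L / h + 1 + 1 := Nat.ceil_lt_add_one (by positivity)
  have hnh : 2 * L + h ≤ n * h := by
    calc 2 * L + h = (2 * L / h + 1) * h := by field_simp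
      _ ≤ n * h := by gcongr
  refine (abs_sub_le_of_eVariationOn_le hh hw n 0 zero_le_one hcont hmaps'
    (hvar.le.trans (ENNReal.ofReal_le_ofReal hnh))).trans ?_
  exact mul_le_mul_of_nonneg_right (by linarith) hA

/-- A family of functions with uniformly bounded oscillation at some positive scale has uniformly
bounded oscillation on a totally bounded connected set. -/
theorem exists_oscillation_bound {X ι : Type*} [PseudoMetricSpace X] {S : Set X}
    (hS : TotallyBounded S) (hSc : IsPreconnected S) {U : ι → X → ℝ} {δ M : ℝ} (hδ : 0 < δ)
    (hU : ∀ i, ∀ x ∈ S, ∀ y ∈ S, dist x y < δ → |U i x - U i y| ≤ M) :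
    ∃ B, ∀ i, ∀ x ∈ S, ∀ y ∈ S, |U i x - U i y| ≤ B := by
  have hpair : ∀ x ∈ S, ∀ y ∈ S, ∃ B, ∀ i, |U i x - U i y| ≤ B := by
    intro x hx y hy
    refine hSc.induction₂ (fun x y => ∃ B, ∀ i, |U i x - U i y| ≤ B) ?_ ?_ ?_ hx hy
    · intro x hx
      filter_upwards [self_mem_nhdsWithin, mem_nhdsWithin_of_mem_nhds (Metric.ball_mem_nhds x hδ)]
        with y hy hxy
      exact ⟨M, fun i => hU i x hx y hy (by rwa [dist_comm])⟩
    · rintro x y z - - - ⟨B, hB⟩ ⟨C, hC⟩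
      exact ⟨B + C, fun i => (abs_sub_le _ (U i y) _).trans (add_le_add (hB i) (hC i))⟩
    · rintro x y - - ⟨B, hB⟩
      exact ⟨B, fun i => abs_sub_comm (U i x) _ ▸ hB i⟩
  obtain ⟨t, htS, htf, hcov⟩ := Metric.finite_approx_of_totallyBounded hS δ hδ
  choose! B hB using hpair
  obtain ⟨C, hC⟩ := ((htf.prod htf).image fun q => B q.1 q.2).bddAbove
  refine ⟨M + C + M, fun i x hx y hy => ?_⟩
  obtain ⟨p, hp, hxp⟩ := mem_iUnion₂.1 (hcov hx)
  obtain ⟨q, hq, hyq⟩ := mem_iUnion₂.1 (hcov hy)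
  have h₁ := hU i x hx p (htS hp) hxp
  have h₂ := (hB p (htS hp) q (htS hq) i).trans (hC ⟨(p, q), ⟨hp, hq⟩, rfl⟩)
  have h₃ := hU i q (htS hq) y hy (by rw [dist_comm]; exact hyq)
  have h₄ := abs_sub_le (U i x) (U i p) (U i y)
  have h₅ := abs_sub_le (U i p) (U i q) (U i y)
  linarith

/-- The Arzelà–Ascoli theorem for asymptotically equicontinuous sequences of (possibly
discontinuous) functions. -/
theorem exists_subseq_tendstoUniformlyOn {X : Type*} [PseudoMetricSpace X] {S : Set X}
    (hS : TotallyBounded S) {U : ℕ → X → ℝ}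
    (hbdd : ∃ B, ∀ n, ∀ x ∈ S, |U n x| ≤ B)
    (hequi : ∀ ε > 0, ∃ δ > 0, ∃ N, ∀ n ≥ N, ∀ x ∈ S, ∀ y ∈ S,
      dist x y < δ → |U n x - U n y| ≤ ε) :
    ∃ ψ : ℕ → ℕ, StrictMono ψ ∧ ∃ v : X → ℝ,
      TendstoUniformlyOn (fun k => U (ψ k)) v atTop S := by
  obtain ⟨B, hB⟩ := hbdd
  choose t htS htf hcov using fun m : ℕ =>
    Metric.finite_approx_of_totallyBounded hS (1 / (m + 1 : ℝ)) Nat.one_div_pos_of_nat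
  let D : Set X := ⋃ m, t m
  have hDS : D ⊆ S := iUnion_subset htS
  have : Countable D := (countable_iUnion fun m => (htf m).countable).to_subtype
  obtain ⟨a, -, ψ, hψ, ha⟩ :=
    (isCompact_univ_pi fun _ : D => isCompact_Icc (a := -B) (b := B)).tendsto_subseq
      (x := fun n (q : D) => U n q) fun n q _ => abs_le.1 (hB n q (hDS q.2))
  rw [tendsto_pi_nhds] at ha
  have hcauchy : UniformCauchySeqOn (fun k => U (ψ k)) atTop S := by
    rw [Metric.uniformCauchySeqOn_iff]
    intro ε hε
    obtain ⟨δ, hδ, N, hN⟩ := hequi (ε / 4) (by positivity)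
    obtain ⟨m, hm⟩ := exists_nat_one_div_lt hδ
    have hnet : ∀ᶠ k in atTop, ∀ l ≥ k, ∀ q ∈ t m, ∀ k' ≥ k,
        |U (ψ k') q - U (ψ l) q| < ε / 4 := by
      have hq : ∀ q ∈ t m, ∀ᶠ k in atTop, ∀ k' ≥ k, ∀ l ≥ k,
          |U (ψ k') q - U (ψ l) q| < ε / 4 := by
        intro q hq
        obtain ⟨K, hK⟩ := Metric.cauchySeq_iff.1
          (ha ⟨q, mem_iUnion.2 ⟨m, hq⟩⟩).cauchySeq (ε / 4) (by positivity)
        filter_upwards [eventually_ge_atTop K] with k hk k' hk' l hl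
        exact hK k' (hk.trans hk') l (hk.trans hl)
      filter_upwards [(htf m).eventually_all.2 hq] with k hk l hl q hq k' hk'
      exact hk q hq k' hk' l hl
    obtain ⟨K, hK, hKN⟩ := (hnet.and (eventually_ge_atTop N)).exists
    refine ⟨K, fun k hk l hl x hx => ?_⟩
    obtain ⟨q, hq, hxq⟩ := mem_iUnion₂.1 (hcov m hx)
    have hd : dist x q < δ := hxq.trans hm
    have h₁ := hN (ψ k) (hKN.trans (hk.trans hψ.le_apply)) x hx q (htS m hq) hd
    have h₂ := hK l hl q hq k hk
    have h₃ := hN (ψ l) (hKN.trans (hl.trans hψ.le_apply)) q (htS m hq) x hx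
      (by rwa [dist_comm])
    have h₄ := abs_sub_le (U (ψ k) x) (U (ψ k) q) (U (ψ l) x)
    have h₅ := abs_sub_le (U (ψ k) q) (U (ψ l) q) (U (ψ l) x)
    rw [Real.dist_eq]
    linarith
  have hlim : ∀ x ∈ S, ∃ y, Tendsto (fun k => U (ψ k) x) atTop (𝓝 y) := by
    intro x hx
    refine cauchySeq_tendsto_of_complete (Metric.cauchySeq_iff.2 fun ε hε => ?_)
    obtain ⟨N, hN⟩ := Metric.uniformCauchySeqOn_iff.1 hcauchy ε hε
    exact ⟨N, fun m hm n hn => hN m hm n hn x hx⟩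
  choose! v hv using hlim
  exact ⟨ψ, hψ, v, hcauchy.tendstoUniformlyOn_of_tendsto hv⟩

/-- Uniform convergence on `Ω` of almost everywhere equal representatives implies convergence in
`L^∞(Ω)`. -/
theorem tendstoLinf_of_tendstoUniformlyOn {Ω : Set (Euc d)} (hΩ : MeasurableSet Ω)
    {un U : ℕ → Euc d → ℝ} {v : Euc d → ℝ} (hae : ∀ n, un n =ᵐ[volume.restrict Ω] U n)
    (hU : TendstoUniformlyOn U v atTop Ω) : TendstoLinf Ω un v := by
  rw [TendstoLinf, ENNReal.tendsto_nhds_zero]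
  intro ε hε
  obtain ⟨r, hr, hrε⟩ := ENNReal.lt_iff_exists_nnreal_btwn.1 hε
  filter_upwards [Metric.tendstoUniformlyOn_iff.1 hU r (by exact_mod_cast hr)] with n hn
  refine (essSup_le_of_ae_le (r : ℝ≥0∞) ?_).trans hrε.le
  filter_upwards [hae n, ae_restrict_mem hΩ] with x hx hxΩ
  have := hn x hxΩ
  rw [hx, ENNReal.coe_le_coe, ← NNReal.coe_le_coe, coe_nnnorm, Real.norm_eq_abs, abs_sub_comm,
    ← Real.dist_eq]
  exact this.le

/-- The kernel is bounded below by half its value at `0` near `0`. -/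
theorem IsKernel.exists_half_le {η : ℝ → ℝ} {c : ℝ} (hη : IsKernel η c) :
    ∃ t > 0, ∀ r, 0 ≤ r → r ≤ t → η 0 / 2 ≤ η r := by
  obtain ⟨t, ht, hball⟩ := Metric.eventually_nhds_iff.1
    (hη.cont_zero.eventually (lt_mem_nhds (half_lt_self hη.pos_zero)))
  refine ⟨t / 2, by positivity, fun r hr hrt => (hball ?_).le⟩
  rw [Real.dist_eq, sub_zero, abs_of_nonneg hr]
  linarith

/-- A bound on the discrete functional controls differences at the scale `t * s` on which the
kernel is bounded below by `m`. -/
theorem abs_sub_le_of_Edisc_le {G : Set (Euc d)} {η : ℝ → ℝ} {f : Euc d → ℝ}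
    {s t m C : ℝ} (hs : 0 < s)
    (hm : 0 < m) (hC : 0 ≤ C) (hη : ∀ r, 0 ≤ r → r ≤ t → m ≤ η r)
    (hE : Edisc G η s f ≤ ENNReal.ofReal C) {x y : Euc d} (hx : x ∈ G) (hy : y ∈ G)
    (hxy : dist x y ≤ t * s) : |f x - f y| ≤ C / m * s := by
  have h₁ : ENNReal.ofReal (1 / s) * ENNReal.ofReal (η (dist x y / s) * |f x - f y|)
      ≤ ENNReal.ofReal C := by
    refine le_trans ?_ hE
    unfold Edisc
    gcongr
    exact le_iSup₂_of_le x hx (le_iSup₂_of_le y hy le_rfl)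
  rw [← ENNReal.ofReal_mul (by positivity), ENNReal.ofReal_le_ofReal_iff hC] at h₁
  have h₂ := mul_le_mul_of_nonneg_right
    (hη (dist x y / s) (by positivity) ((div_le_iff₀ hs).2 hxy)) (abs_nonneg (f x - f y))
  rw [one_div, inv_mul_le_iff₀ hs] at h₁
  rw [div_mul_eq_mul_div, le_div_iff₀ hm]
  linarith

theorem IsCPP.dist_le_resol {Ω G : Set (Euc d)} {p : Euc d → Euc d} (hp : IsCPP Ω G p)
    (hΩ : Bornology.IsBounded Ω) (hG : G.Nonempty) {x : Euc d} (hx : x ∈ Ω) :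
    dist x (p x) ≤ resol Ω G := by
  obtain ⟨z, hz⟩ := hG
  obtain ⟨R, hR⟩ := hΩ.subset_closedBall z
  have hbdd : BddAbove (range fun x => ⨆ _ : x ∈ Ω, Metric.infDist x G) := by
    refine ⟨max R 0, ?_⟩
    rintro _ ⟨x, rfl⟩
    by_cases hx : x ∈ Ω
    · simp only [hx, ciSup_pos]
      exact ((Metric.infDist_le_dist_of_mem hz).trans (hR hx)).trans (le_max_left _ _)
    · simp [hx]
  calc dist x (p x) ≤ Metric.infDist x G := (Metric.le_infDist ⟨z, hz⟩).2 fun y hy => (hp x hx).2 y hy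
    _ = ⨆ _ : x ∈ Ω, Metric.infDist x G := by simp [hx]
    _ ≤ resol Ω G := le_ciSup hbdd x

/-- Compactness of the constrained discrete functionals: sequences with uniformly bounded
constrained discrete energies are relatively compact in `L^∞(Ω)`. -/
theorem statement_14 {d : ℕ} (Ω : Set (Euc d)) (hΩo : IsOpen Ω) (hΩc : IsConnected Ω)
    (hΩb : Bornology.IsBounded Ω) (hD : condD Ω)
    (η : ℝ → ℝ) (c : ℝ) (hη : IsKernel η c)
    (g : Euc d → ℝ) (Kg : NNReal) (hg : LipschitzOnWith Kg g (closure Ω))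
    (Ωn : ℕ → Set (Euc d)) (hfin : ∀ n, (Ωn n).Finite) (hne : ∀ n, (Ωn n).Nonempty)
    (hsub : ∀ n, Ωn n ⊆ closure Ω)
    (pn : ℕ → Euc d → Euc d) (hpn : ∀ n, IsCPP Ω (Ωn n) (pn n))
    (On : ℕ → Set (Euc d)) (hOnsub : ∀ n, On n ⊆ Ωn n) (hOnne : ∀ n, (On n).Nonempty)
    (O : Set (Euc d)) (hO : IsClosed O) (hOsub : O ⊆ closure Ω) (hOne : O.Nonempty)
    (s : ℕ → ℝ) (hs : ∀ n, 0 < s n) (hs0 : Filter.Tendsto s Filter.atTop (nhds 0))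
    (hscale : Filter.Tendsto (fun n => resol Ω (Ωn n) / s n) Filter.atTop (nhds 0))
    (hH : Filter.Tendsto (fun n => Metric.hausdorffDist (On n) O / s n) Filter.atTop (nhds 0))
    (un : ℕ → Euc d → ℝ)
    (hE : (⨆ n, EdiscCons Ω (Ωn n) (On n) (pn n) g η (s n) (un n)) ≠ ⊤) :
    SeqRelCompactLinf Ω un := by
  set C := (⨆ n, EdiscCons Ω (Ωn n) (On n) (pn n) g η (s n) (un n)).toReal + 1
  have hC : 0 ≤ C := by positivity
  have hlt : ∀ n, EdiscCons Ω (Ωn n) (On n) (pn n) g η (s n) (un n) < ENNReal.ofReal C :=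
    fun n => (le_iSup (fun n => EdiscCons Ω (Ωn n) (On n) (pn n) g η (s n) (un n)) n).trans_lt
      ((ENNReal.lt_ofReal_iff_toReal_lt hE).2 (lt_add_one _))
  simp only [EdiscCons, iInf_lt_iff] at hlt
  choose f hae hfg hfE using hlt
  obtain ⟨t, ht, hηt⟩ := hη.exists_half_le
  obtain ⟨δ, hδ, hgeo⟩ := hD 1 one_pos
  have hη0 : 0 < η 0 / 2 := half_pos hη.pos_zero
  set A := C / (η 0 / 2)
  have hA : 0 ≤ A := by positivity
  obtain ⟨N, hN⟩ : ∃ N, ∀ n ≥ N, resol Ω (Ωn n) ≤ t / 4 * s n ∧ s n < 1 := by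
    refine eventually_atTop.1 ?_
    filter_upwards [hscale.eventually (gt_mem_nhds (show 0 < t / 4 by positivity)),
      hs0.eventually (gt_mem_nhds one_pos)] with n h₁ h₂
    exact ⟨((div_lt_iff₀ (hs n)).1 h₁).le, h₂⟩
  have hdisc : ∀ n, ∀ p ∈ Ωn n, ∀ q ∈ Ωn n, dist p q ≤ t * s n → |f n p - f n q| ≤ A * s n :=
    fun n p hp q hq => abs_sub_le_of_Edisc_le (hs n) hη0 hC hηt (hfE n).le hp hq
  have hosc : ∀ n ≥ N, ∀ x ∈ Ω, ∀ y ∈ Ω, dist x y < δ →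
      |f n (pn n x) - f n (pn n y)| ≤ A * (4 * dist x y / t + 3 * s n) := by
    intro n hn x hx y hy hxy
    have hsn := hs n
    have := abs_sub_le_of_geoDist_le (w := fun x => f n (pn n x)) (h := t / 2 * s n)
      (A := A * s n) (by positivity) ?_ hx hy
      (by simpa [one_add_one_eq_two] using hgeo x hx y hy hxy)
    · refine this.trans_eq ?_
      field_simp
      ring
    · intro p hp q hq hpq
      refine hdisc n _ (hpn n p hp).1 _ (hpn n q hq).1 ?_
      have h₁ := (hpn n).dist_le_resol hΩb (hne n) hp
      have h₂ := (hpn n).dist_le_resol hΩb (hne n) hq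
      have h₃ := dist_triangle4 (pn n p) p q (pn n q)
      rw [dist_comm (pn n p) p] at h₃
      linarith [(hN n hn).1]
  have hΩt : TotallyBounded Ω := hΩb.isCompact_closure.totallyBounded.subset subset_closure
  obtain ⟨B, hB⟩ := exists_oscillation_bound (ι := {n // N ≤ n}) hΩt hΩc.isPreconnected
    (U := fun n x => f n (pn n x)) (M := A * (4 * δ / t + 3)) hδ
    fun n x hx y hy hxy => (hosc n n.2 x hx y hy hxy).trans (by
      have := (hN n n.2).2
      gcongr
      linarith)
  obtain ⟨G, hG⟩ : ∃ G, ∀ z ∈ closure Ω, |g z| ≤ G := by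
    obtain ⟨G, hG⟩ := hΩb.isCompact_closure.exists_bound_of_continuousOn hg.continuousOn
    exact ⟨G, hG⟩
  have hbound : ∀ n ≥ N, ∀ x ∈ Ω, |f n (pn n x)| ≤ B + A + G := by
    intro n hn x hx
    have hsn := hs n
    obtain ⟨z, hz⟩ := hOnne n
    have hzn := hOnsub n hz
    obtain ⟨y, hy, hzy⟩ := Metric.mem_closure_iff.1 (hsub n hzn) (t / 2 * s n) (by positivity)
    have hclose : dist (pn n y) z ≤ t * s n := by
      have h₁ := (hpn n y hy).2 z hzn
      have h₂ := dist_triangle_left (pn n y) z y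
      rw [dist_comm] at hzy
      linarith
    have h₁ := hB ⟨n, hn⟩ x hx y hy
    have h₂ := hdisc n _ (hpn n y hy).1 z hzn hclose
    have h₃ : |f n z| ≤ G := hfg n hz ▸ hG z (hsub n hzn)
    have h₄ : A * s n ≤ A := mul_le_of_le_one_right hA (hN n hn).2.le
    simp only [abs_le] at *
    constructor <;> linarith
  intro φ hφ
  have hφN : ∀ k, N ≤ φ (k + N) := fun k => (Nat.le_add_left N k).trans hφ.le_apply
  obtain ⟨ψ, hψ, v, hv⟩ := exists_subseq_tendstoUniformlyOn hΩt
    (U := fun k x => f (φ (k + N)) (pn (φ (k + N)) x))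
    ⟨_, fun k => hbound _ (hφN k)⟩ (by
      intro ε hε
      obtain ⟨τ, hτ, hAτ⟩ : ∃ τ > 0, A * (4 * τ / t + 3 * τ) ≤ ε := by
        refine ⟨ε / ((A + 1) * (4 / t + 3)), by positivity, ?_⟩
        calc _ = A / (A + 1) * ε := by field_simp
          _ ≤ 1 * ε := by
            gcongr
            exact (div_le_one (by positivity)).2 (by linarith)
          _ = ε := one_mul ε
      have hshift : Tendsto (fun k => s (φ (k + N))) atTop (𝓝 0) :=
        hs0.comp (hφ.tendsto_atTop.comp (tendsto_add_atTop_nat N))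
      obtain ⟨K, hK⟩ := eventually_atTop.1 (hshift.eventually (gt_mem_nhds hτ))
      refine ⟨min δ τ, lt_min hδ hτ, K, fun k hk x hx y hy hxy => ?_⟩
      refine (hosc _ (hφN k) x hx y hy (hxy.trans_le (min_le_left _ _))).trans (le_trans ?_ hAτ)
      have h₁ := (hxy.trans_le (min_le_right _ _)).le
      have h₂ := (hK k hk).le
      gcongr)
  exact ⟨fun k => ψ k + N, fun _ _ h => Nat.add_lt_add_right (hψ h) N, v,
    tendstoLinf_of_tendstoUniformlyOn hΩo.measurableSet (fun k => hae _) hv⟩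


end
end
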